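/- Local Hörmander-type bound from restriction to a small sphere (Lᵖ version): for every n ≥ 2 and every real p ≥ 2 there exist constants κ > 0 and C > 0, depending only on n and p, such that for every λ > 0, every x₀ ∈ ℝⁿ, every R > κ/λ, and every C² function ψ on the ball B_R(x₀) ⊂ ℝⁿ satisfying Δψ = −λ²ψ there, one has |ψ(x₀)| ≤ C·λ^{(n−1)/p}·( ∫_{∂B_{κ/λ}(x₀)} |ψ(y)|ᵖ dσ(y) )^{1/p}, where the integral is taken over the sphere of radius κ/λ centered at x₀ with respect to the (n−1)-dimensional surface measure σ. -/

import Mathlib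

open MeasureTheory Metric Set Filter

/-- The Euclidean Laplacian: sum of second partial derivatives. -/
noncomputable def lap {n : ℕ} (f : EuclideanSpace ℝ (Fin n) → ℝ)
    (x : EuclideanSpace ℝ (Fin n)) : ℝ :=
  ∑ i : Fin n, fderiv ℝ (fun y => fderiv ℝ f y (EuclideanSpace.single i 1)) x
      (EuclideanSpace.single i 1)

open scoped Topology

theorem lh_int {E : Type*} [NormedAddCommGroup E] [MeasurableSpace E] [BorelSpace E]
    [SecondCountableTopology E] (μ : Measure E) (K : Set E) (hK : IsCompact K) (hμ : μ K ≠ ⊤)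
    (f : E → ℝ) (hf : ContinuousOn f K) : Integrable f (μ.restrict K) := by
  have hm := hK.measurableSet
  have : IsFiniteMeasure (μ.restrict K) := ⟨by simpa using lt_top_iff_ne_top.2 hμ⟩
  obtain ⟨B, hB⟩ := hK.exists_bound_of_continuousOn hf
  exact Integrable.of_bound (hf.aestronglyMeasurable hm) B
    ((ae_restrict_iff' hm).2 (ae_of_all _ hB))

theorem lh_param {E : Type*} [NormedAddCommGroup E] [MeasurableSpace E] [BorelSpace E]
    [SecondCountableTopology E] (μ : Measure E) (K : Set E) (hK : IsCompact K) (hμ : μ K ≠ ⊤)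
    (H H' : ℝ → E → ℝ) (U : Set ℝ) (hU : IsOpen U)
    (hH : ContinuousOn (fun q : ℝ × E => H q.1 q.2) (U ×ˢ K))
    (hH' : ContinuousOn (fun q : ℝ × E => H' q.1 q.2) (U ×ˢ K))
    (hd : ∀ t ∈ U, ∀ w ∈ K, HasDerivAt (fun s => H s w) (H' t w) t) (t₀ : ℝ) (ht : t₀ ∈ U) :
    HasDerivAt (fun t => ∫ w in K, H t w ∂μ) (∫ w in K, H' t₀ w ∂μ) t₀ := by
  obtain ⟨ε, hε, hsub⟩ := Metric.nhds_basis_closedBall.mem_iff.1 (hU.mem_nhds ht)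
  have hc : ∀ G : ℝ → E → ℝ, ContinuousOn (fun q : ℝ × E => G q.1 q.2) (U ×ˢ K) →
      ∀ t ∈ U, ContinuousOn (G t) K := by
    intro G hG t htU
    exact hG.comp (f := fun w => (t, w)) (by fun_prop) (fun w hw => ⟨htU, hw⟩)
  have hm := hK.measurableSet
  have : IsFiniteMeasure (μ.restrict K) := ⟨by simpa using lt_top_iff_ne_top.2 hμ⟩
  obtain ⟨B, hB⟩ := ((isCompact_closedBall t₀ ε).prod hK).exists_bound_of_continuousOn
    (hH'.mono (prod_mono hsub subset_rfl))
  refine (hasDerivAt_integral_of_dominated_loc_of_deriv_le (bound := fun _ => B)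
    (closedBall_mem_nhds t₀ hε) ?_ ?_ ?_ ?_ ?_ ?_).2
  · filter_upwards [hU.mem_nhds ht] with t htU
    exact (hc H hH t htU).aestronglyMeasurable hm
  · exact lh_int μ K hK hμ _ (hc H hH t₀ ht)
  · exact (hc H' hH' t₀ ht).aestronglyMeasurable hm
  · exact (ae_restrict_iff' hm).2 (ae_of_all _ fun w hw t htt => hB (t, w) ⟨htt, hw⟩)
  · exact integrable_const _
  · exact (ae_restrict_iff' hm).2 (ae_of_all _ fun w hw t htt => hd t (hsub htt) w hw)

/-- generator of the rotation in the `(i,j)` plane -/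
noncomputable def lhA {n : ℕ} (i j : Fin n) (x : EuclideanSpace ℝ (Fin n)) :
    EuclideanSpace ℝ (Fin n) :=
  x i • EuclideanSpace.single j 1 - x j • EuclideanSpace.single i 1

/-- rotation in the `(i,j)` plane -/
noncomputable def lhG {n : ℕ} (i j : Fin n) (t : ℝ) (x : EuclideanSpace ℝ (Fin n)) :
    EuclideanSpace ℝ (Fin n) :=
  x + (Real.cos t - 1) • (x i • EuclideanSpace.single i 1 + x j • EuclideanSpace.single j 1)
    + Real.sin t • lhA i j x

theorem lhG_norm {n : ℕ} {i j : Fin n} (h : i ≠ j) (t : ℝ) (x : EuclideanSpace ℝ (Fin n)) :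
    ‖lhG i j t x‖ = ‖x‖ := by
  have h2 : ‖lhG i j t x‖ ^ 2 = ‖x‖ ^ 2 := by
    rw [← real_inner_self_eq_norm_sq, ← real_inner_self_eq_norm_sq]
    simp only [lhG, lhA, inner_add_left, inner_add_right, inner_sub_left, inner_sub_right,
      real_inner_smul_left, real_inner_smul_right, EuclideanSpace.inner_single_left,
      EuclideanSpace.inner_single_right]
    simp [h, h.symm]
    have := Real.sin_sq_add_cos_sq t
    linear_combination (x i ^ 2 + x j ^ 2) * this
  exact (pow_left_inj₀ (norm_nonneg _) (norm_nonneg _) two_ne_zero).1 h2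

theorem lhG_equiv {n : ℕ} {i j : Fin n} (h : i ≠ j) (t : ℝ) :
    ∃ e : EuclideanSpace ℝ (Fin n) ≃ₗᵢ[ℝ] EuclideanSpace ℝ (Fin n), ∀ x, e x = lhG i j t x := by
  let L : EuclideanSpace ℝ (Fin n) →ₗ[ℝ] EuclideanSpace ℝ (Fin n) :=
    { toFun := lhG i j t
      map_add' := fun x y => by
        simp only [lhG, lhA, PiLp.add_apply]; module
      map_smul' := fun c x => by
        simp only [lhG, lhA, PiLp.smul_apply, RingHom.id_apply, smul_eq_mul]; module }
  let I : EuclideanSpace ℝ (Fin n) →ₗᵢ[ℝ] EuclideanSpace ℝ (Fin n) :=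
    ⟨L, fun x => lhG_norm h t x⟩
  exact ⟨I.toLinearIsometryEquiv rfl, fun x => rfl⟩

theorem lh_inv {n : ℕ} {i j : Fin n} (h : i ≠ j) (d : ℝ) (t : ℝ)
    (f : EuclideanSpace ℝ (Fin n) → ℝ) :
    ∫ w in sphere 0 1, f (lhG i j t w) ∂(μH[d]) = ∫ w in sphere 0 1, f w ∂(μH[d]) := by
  obtain ⟨e, he⟩ := lhG_equiv h t
  have hmp := e.toIsometryEquiv.measurePreserving_hausdorffMeasure d
  have := hmp.setIntegral_preimage_emb
    (e.toHomeomorph.measurableEmbedding) f (sphere 0 1)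
  have hpre : (e.toIsometryEquiv : EuclideanSpace ℝ (Fin n) → _) ⁻¹' (sphere 0 1) = sphere 0 1 := by
    ext x; simp
  rw [hpre] at this
  rw [← this]
  simp only [← he]
  rfl

theorem lh_rot {n : ℕ} (d : ℝ) (hfin : μH[d] (sphere (0 : EuclideanSpace ℝ (Fin n)) 1) ≠ ⊤)
    (i j : Fin n) (x₀ : EuclideanSpace ℝ (Fin n)) (R r : ℝ) (hr : 0 < r) (hrR : r < R)
    (f : EuclideanSpace ℝ (Fin n) → ℝ) (hf : ContDiffOn ℝ 1 f (ball x₀ R)) :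
    ∫ w in sphere (0 : EuclideanSpace ℝ (Fin n)) 1, fderiv ℝ f (x₀ + r • w) (lhA i j w) ∂(μH[d])
      = 0 := by
  by_cases hij : i = j
  · subst hij; simp [lhA]
  have hmem : ∀ t : ℝ, ∀ w ∈ sphere (0 : EuclideanSpace ℝ (Fin n)) 1,
      x₀ + r • lhG i j t w ∈ ball x₀ R := by
    intro t w hw
    have hw' : ‖w‖ = 1 := by simpa using hw
    simp [norm_smul, lhG_norm hij, hw', abs_of_pos hr, hrR]
  have hcont : Continuous fun q : ℝ × EuclideanSpace ℝ (Fin n) => x₀ + r • lhG i j q.1 q.2 := by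
    unfold lhG lhA; fun_prop
  let G' : ℝ → EuclideanSpace ℝ (Fin n) → EuclideanSpace ℝ (Fin n) := fun t w =>
    r • ((- Real.sin t) • (w i • EuclideanSpace.single i 1 + w j • EuclideanSpace.single j 1)
      + Real.cos t • lhA i j w)
  have hcont' : Continuous fun q : ℝ × EuclideanSpace ℝ (Fin n) => G' q.1 q.2 := by
    simp only [G', lhA]; fun_prop
  have hfd : ContinuousOn (fderiv ℝ f) (ball x₀ R) :=
    hf.continuousOn_fderiv_of_isOpen isOpen_ball le_rfl
  have key := lh_param (μH[d]) (sphere (0 : EuclideanSpace ℝ (Fin n)) 1) (isCompact_sphere 0 1) hfin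
    (fun t w => f (x₀ + r • lhG i j t w))
    (fun t w => fderiv ℝ f (x₀ + r • lhG i j t w) (G' t w)) univ isOpen_univ
    (hf.continuousOn.comp hcont.continuousOn fun q hq => hmem _ _ hq.2)
    ((hfd.comp hcont.continuousOn fun q hq => hmem _ _ hq.2).clm_apply hcont'.continuousOn)
    (by
      intro t _ w hw
      have h1 : HasFDerivAt f (fderiv ℝ f (x₀ + r • lhG i j t w)) (x₀ + r • lhG i j t w) :=
        ((hf.differentiableOn one_ne_zero).differentiableAt
          (isOpen_ball.mem_nhds (hmem t w hw))).hasFDerivAt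
      have h2 : HasDerivAt (fun s => x₀ + r • lhG i j s w) (G' t w) t := by
        have ha := (((Real.hasDerivAt_cos t).sub_const 1).smul_const
          (w i • EuclideanSpace.single i (1:ℝ) + w j • EuclideanSpace.single j (1:ℝ))).const_add w
        have hb := (Real.hasDerivAt_sin t).smul_const (lhA i j w)
        exact ((ha.add hb).const_smul r).const_add x₀
      exact h1.comp_hasDerivAt t h2) 0 (mem_univ _)
  have hconst : (fun t : ℝ => ∫ w in sphere (0 : EuclideanSpace ℝ (Fin n)) 1,
      f (x₀ + r • lhG i j t w) ∂(μH[d])) = fun _ =>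
      ∫ w in sphere (0 : EuclideanSpace ℝ (Fin n)) 1, f (x₀ + r • w) ∂(μH[d]) := by
    funext t
    exact lh_inv hij d t (fun w => f (x₀ + r • w))
  rw [hconst] at key
  have h0 := key.unique (hasDerivAt_const _ _)
  simp only [G', lhG, Real.cos_zero, Real.sin_zero, sub_self, zero_smul, add_zero, neg_zero,
    zero_add, one_smul, map_smul, smul_eq_mul] at h0
  rw [integral_const_mul] at h0
  exact (mul_eq_zero.1 h0).resolve_left hr.ne'

theorem lh_div {n : ℕ} (d : ℝ) (hfin : μH[d] (sphere (0 : EuclideanSpace ℝ (Fin n)) 1) ≠ ⊤)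
    (x₀ : EuclideanSpace ℝ (Fin n)) (R r : ℝ) (hr : 0 < r) (hrR : r < R)
    (F : Fin n → EuclideanSpace ℝ (Fin n) → ℝ) (hF : ∀ j, ContDiffOn ℝ 1 (F j) (ball x₀ R)) :
    (1 - (n : ℝ)) * (∫ w in sphere (0 : EuclideanSpace ℝ (Fin n)) 1,
        ∑ j, w j * F j (x₀ + r • w) ∂(μH[d]))
      + r * (∫ w in sphere (0 : EuclideanSpace ℝ (Fin n)) 1,
        ∑ j, fderiv ℝ (F j) (x₀ + r • w) (EuclideanSpace.single j 1) ∂(μH[d]))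
      - r * (∫ w in sphere (0 : EuclideanSpace ℝ (Fin n)) 1,
        ∑ j, w j * fderiv ℝ (F j) (x₀ + r • w) w ∂(μH[d])) = 0 := by
  have hmem : ∀ w ∈ sphere (0 : EuclideanSpace ℝ (Fin n)) 1, x₀ + r • w ∈ ball x₀ R := by
    intro w hw
    have hw' : ‖w‖ = 1 := by simpa using hw
    simp [norm_smul, hw', abs_of_pos hr, hrR]
  have hcont : ContinuousOn (fun w : EuclideanSpace ℝ (Fin n) => x₀ + r • w) (sphere 0 1) := by
    fun_prop
  have hFc : ∀ j, ContinuousOn (fun w => F j (x₀ + r • w)) (sphere 0 1) := fun j =>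
    (hF j).continuousOn.comp hcont hmem
  have hDc : ∀ j, ContinuousOn (fun w => fderiv ℝ (F j) (x₀ + r • w)) (sphere 0 1) := fun j =>
    ((hF j).continuousOn_fderiv_of_isOpen isOpen_ball le_rfl).comp hcont hmem
  have hco : ∀ j : Fin n, ContinuousOn (fun w : EuclideanSpace ℝ (Fin n) => w j) (sphere 0 1) := by
    intro j; fun_prop
  have hI := fun f hf => lh_int (μH[d]) (sphere (0 : EuclideanSpace ℝ (Fin n)) 1)
    (isCompact_sphere 0 1) hfin f hf
  let f : Fin n → Fin n → EuclideanSpace ℝ (Fin n) → ℝ := fun i j y => (y i - x₀ i) * F j y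
  have hf : ∀ i j, ContDiffOn ℝ 1 (f i j) (ball x₀ R) := by
    intro i j
    refine ContDiffOn.mul ?_ (hF j)
    fun_prop
  have hAc : ∀ i j : Fin n, Continuous (lhA i j) := by
    intro i j; unfold lhA; fun_prop
  have hfDc : ∀ i j, ContinuousOn (fun w => fderiv ℝ (f i j) (x₀ + r • w) (lhA i j w))
      (sphere 0 1) := fun i j =>
    ContinuousOn.clm_apply (((hf i j).continuousOn_fderiv_of_isOpen isOpen_ball le_rfl).comp
      hcont hmem) (hAc i j).continuousOn
  have h0 : ∫ w in sphere (0 : EuclideanSpace ℝ (Fin n)) 1,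
      ∑ i, ∑ j, fderiv ℝ (f i j) (x₀ + r • w) (lhA i j w) ∂(μH[d]) = 0 := by
    rw [integral_finsetSum _ (fun i _ => integrable_finsetSum _ fun j _ => hI _ (hfDc i j))]
    refine Finset.sum_eq_zero fun i _ => ?_
    rw [integral_finsetSum _ (fun j _ => hI _ (hfDc i j))]
    exact Finset.sum_eq_zero fun j _ => lh_rot d hfin i j x₀ R r hr hrR _ (hf i j)
  rw [← integral_const_mul, ← integral_const_mul, ← integral_const_mul, ← integral_add,
    ← integral_sub, ← h0]
  · refine setIntegral_congr_fun isClosed_sphere.measurableSet fun w hw => ?_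
    have hw' : ‖w‖ = 1 := by simpa using hw
    have hsq : ∑ i, w i * w i = 1 := by
      have := EuclideanSpace.real_norm_sq_eq w
      rw [hw'] at this
      simp only [← pow_two]; linarith
    have hwv : w = ∑ i, w i • EuclideanSpace.single i (1 : ℝ) := by
      ext k; simp [Finset.sum_apply, Pi.single_apply]
    have hfd : ∀ i j, ∀ v, fderiv ℝ (f i j) (x₀ + r • w) v
        = v i * F j (x₀ + r • w) + r * w i * fderiv ℝ (F j) (x₀ + r • w) v := by
      intro i j v
      have h1 : HasFDerivAt (F j) (fderiv ℝ (F j) (x₀ + r • w)) (x₀ + r • w) :=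
        (((hF j).differentiableOn one_ne_zero).differentiableAt
          (isOpen_ball.mem_nhds (hmem w hw))).hasFDerivAt
      have h2 : HasFDerivAt (fun y : EuclideanSpace ℝ (Fin n) => y i - x₀ i)
          (EuclideanSpace.proj i : EuclideanSpace ℝ (Fin n) →L[ℝ] ℝ) (x₀ + r • w) :=
        (EuclideanSpace.proj i : EuclideanSpace ℝ (Fin n) →L[ℝ] ℝ).hasFDerivAt.sub_const _
      have h3 := (h2.mul h1).fderiv
      simp only [f]
      erw [h3]
      simp
      ring
    have hAi : ∀ i j : Fin n, (lhA i j w) i = (if i = j then w i else 0) - w j := by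
      intro i j
      simp [lhA]
    have hD : ∀ j, fderiv ℝ (F j) (x₀ + r • w) w
        = ∑ i, w i * fderiv ℝ (F j) (x₀ + r • w) (EuclideanSpace.single i 1) := by
      intro j
      generalize fderiv ℝ (F j) (x₀ + r • w) = T
      conv_lhs => rw [hwv]
      simp [map_sum]
    have hDA : ∀ i j, fderiv ℝ (F j) (x₀ + r • w) (lhA i j w)
        = w i * fderiv ℝ (F j) (x₀ + r • w) (EuclideanSpace.single j 1)
          - w j * fderiv ℝ (F j) (x₀ + r • w) (EuclideanSpace.single i 1) := by
      intro i j; simp [lhA]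
    simp only [hfd, hAi, hDA, hD]
    generalize hG : (fun j => F j (x₀ + r • w)) = G
    generalize hT : (fun j i => fderiv ℝ (F j) (x₀ + r • w) (EuclideanSpace.single i 1)) = T
    have hG' : ∀ j, F j (x₀ + r • w) = G j := fun j => by rw [← hG]
    have hT' : ∀ j i, fderiv ℝ (F j) (x₀ + r • w) (EuclideanSpace.single i 1) = T j i :=
      fun j i => by rw [← hT]
    simp only [hG', hT']
    rw [Finset.sum_comm, Finset.mul_sum, Finset.mul_sum, Finset.mul_sum, ← Finset.sum_add_distrib,
      ← Finset.sum_sub_distrib]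
    refine Finset.sum_congr rfl fun j _ => ?_
    have e : ∀ i, ((if i = j then w i else 0) - w j) * G j
          + r * w i * (w i * T j j - w j * T j i)
        = (if i = j then w i * G j else 0) - w j * G j + r * T j j * (w i * w i)
          - r * w j * (w i * T j i) := by
      intro i; split_ifs <;> ring
    simp only [e, Finset.sum_sub_distrib, Finset.sum_add_distrib, ← Finset.mul_sum, hsq]
    simp
    ring
  · refine ((hI _ ?_).const_mul _).add ((hI _ ?_).const_mul _)
    · exact continuousOn_finsetSum _ fun j _ => (hco j).mul (hFc j)
    · exact continuousOn_finsetSum _ fun j _ => (hDc j).clm_apply continuousOn_const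
  · refine (hI _ ?_).const_mul _
    exact continuousOn_finsetSum _ fun j _ => (hco j).mul ((hDc j).clm_apply continuousOn_id)
  · refine (hI _ ?_).const_mul _
    exact continuousOn_finsetSum _ fun j _ => (hco j).mul (hFc j)
  · refine (hI _ ?_).const_mul _
    exact continuousOn_finsetSum _ fun j _ => (hDc j).clm_apply continuousOn_const

theorem lh_radial {n : ℕ} (d : ℝ) (hfin : μH[d] (sphere (0 : EuclideanSpace ℝ (Fin n)) 1) ≠ ⊤)
    (x₀ : EuclideanSpace ℝ (Fin n)) (R : ℝ) {ι : Type*} [Fintype ι]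
    (g f : ι → EuclideanSpace ℝ (Fin n) → ℝ) (hg : ∀ j, Continuous (g j))
    (hf : ∀ j, ContDiffOn ℝ 1 (f j) (ball x₀ R)) (r : ℝ) (hr : r ∈ Ioo (-R) R) :
    HasDerivAt (fun r : ℝ => ∫ w in sphere (0 : EuclideanSpace ℝ (Fin n)) 1,
        ∑ j, g j w * f j (x₀ + r • w) ∂(μH[d]))
      (∫ w in sphere (0 : EuclideanSpace ℝ (Fin n)) 1,
        ∑ j, g j w * fderiv ℝ (f j) (x₀ + r • w) w ∂(μH[d])) r := by
  have hmem : ∀ r ∈ Ioo (-R) R, ∀ w ∈ sphere (0 : EuclideanSpace ℝ (Fin n)) 1,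
      x₀ + r • w ∈ ball x₀ R := by
    intro r hr w hw
    have hw' : ‖w‖ = 1 := by simpa using hw
    simp [norm_smul, hw', abs_lt, hr.1, hr.2]
  have hcont : Continuous fun q : ℝ × EuclideanSpace ℝ (Fin n) => x₀ + q.1 • q.2 := by
    fun_prop
  have hg' : ∀ j, Continuous fun q : ℝ × EuclideanSpace ℝ (Fin n) => g j q.2 :=
    fun j => (hg j).comp continuous_snd
  refine lh_param (μH[d]) (sphere (0 : EuclideanSpace ℝ (Fin n)) 1) (isCompact_sphere 0 1) hfin
    (fun r w => ∑ j, g j w * f j (x₀ + r • w))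
    (fun r w => ∑ j, g j w * fderiv ℝ (f j) (x₀ + r • w) w) (Ioo (-R) R) isOpen_Ioo
    ?_ ?_ ?_ r hr
  · exact continuousOn_finsetSum _ fun j _ => (hg' j).continuousOn.mul
      ((hf j).continuousOn.comp hcont.continuousOn fun q hq => hmem _ hq.1 _ hq.2)
  · exact continuousOn_finsetSum _ fun j _ => (hg' j).continuousOn.mul
      ((((hf j).continuousOn_fderiv_of_isOpen isOpen_ball le_rfl).comp hcont.continuousOn
        fun q hq => hmem _ hq.1 _ hq.2).clm_apply continuous_snd.continuousOn)
  · intro t ht w hw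
    refine HasDerivAt.fun_sum fun j _ => HasDerivAt.const_mul _ ?_
    have h1 : HasFDerivAt (f j) (fderiv ℝ (f j) (x₀ + t • w)) (x₀ + t • w) :=
      (((hf j).differentiableOn one_ne_zero).differentiableAt
        (isOpen_ball.mem_nhds (hmem t ht w hw))).hasFDerivAt
    have h2 : HasDerivAt (fun s : ℝ => x₀ + s • w) w t := by
      simpa using ((hasDerivAt_id t).smul_const w).const_add x₀
    exact h1.comp_hasDerivAt t h2

theorem lh_ode (k : ℕ) (lam ρ R : ℝ) (hl : 0 < lam) (hρ : ρ = 1 / 2 / lam) (hR : ρ < R)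
    (M N N' : ℝ → ℝ) (hM : ∀ r ∈ Ioo (-R) R, HasDerivAt M (N r) r)
    (hN : ∀ r ∈ Ioo (-R) R, HasDerivAt N (N' r) r)
    (hE : ∀ r, 0 < r → r < R → (k + 1 : ℝ) * N r + r * N' r = - lam ^ 2 * r * M r) :
    |M 0| ≤ 3 / 2 * |M ρ| := by
  have hρ0 : 0 < ρ := by rw [hρ]; positivity
  have hsub : Icc 0 ρ ⊆ Ioo (-R) R := fun x hx => ⟨by linarith [hx.1], by linarith [hx.2]⟩
  have hMc : ContinuousOn M (Icc 0 ρ) := fun x hx => (hM x (hsub hx)).continuousAt.continuousWithinAt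
  have hNc : ContinuousOn N (Icc 0 ρ) := fun x hx => (hN x (hsub hx)).continuousAt.continuousWithinAt
  obtain ⟨m, hm, hmax⟩ := isCompact_Icc.exists_isMaxOn (nonempty_Icc.2 hρ0.le) hMc.abs
  have hS : ∀ x ∈ Icc 0 ρ, |M x| ≤ |M m| := fun x hx => hmax hx
  set S := |M m| with hSdef
  have hS0 : 0 ≤ S := abs_nonneg _
  have hlr : lam ^ 2 * ρ * ρ = 1 / 4 := by rw [hρ]; field_simp; norm_num
  -- bound on N
  have hNb : ∀ s, 0 < s → s ≤ ρ → |N s| ≤ lam ^ 2 * ρ * S := by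
    intro s hs hsρ
    obtain ⟨c, hc, hceq⟩ := exists_hasDerivAt_eq_slope (fun r => r ^ (k + 1) * N r)
      (fun r => - (lam ^ 2 * r ^ (k + 1) * M r)) hs
      ((continuousOn_id.pow _).mul (hNc.mono (Icc_subset_Icc_right hsρ)))
      (by
        intro x hx
        have h1 := (hasDerivAt_pow (k + 1) x).mul (hN x (hsub ⟨hx.1.le, hx.2.le.trans hsρ⟩))
        refine h1.congr_deriv ?_
        have h2 := hE x hx.1 (by linarith [hx.2])
        push_cast
        rw [pow_succ]
        linear_combination x ^ k * h2)
    have hc1 : |M c| ≤ S := hS c ⟨hc.1.le, hc.2.le.trans hsρ⟩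
    have hck : c ^ (k + 1) ≤ s ^ (k + 1) := pow_le_pow_left₀ hc.1.le hc.2.le _
    have hsk : 0 < s ^ (k + 1) := by positivity
    have hck0 : 0 ≤ c ^ (k + 1) := pow_nonneg hc.1.le _
    have e1 : s ^ (k + 1) * N s = - (lam ^ 2 * c ^ (k + 1) * M c) * s := by
      rw [hceq]; simp [hs.ne']
    have e2 : s ^ (k + 1) * |N s| = lam ^ 2 * c ^ (k + 1) * |M c| * s := by
      rw [← abs_of_pos hsk, ← abs_mul, e1, abs_mul, abs_neg, abs_mul, abs_mul, abs_of_nonneg hck0,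
        abs_of_pos hs, abs_of_pos (by positivity : 0 < lam ^ 2)]
    have e3 : s ^ (k + 1) * |N s| ≤ s ^ (k + 1) * (lam ^ 2 * ρ * S) := by
      rw [e2]
      calc lam ^ 2 * c ^ (k + 1) * |M c| * s ≤ lam ^ 2 * s ^ (k + 1) * S * ρ := by gcongr
        _ = _ := by ring
    exact le_of_mul_le_mul_left e3 hsk
  have hMb : ∀ s, 0 < s → s ≤ ρ → |M s - M 0| ≤ S / 4 := by
    intro s hs hsρ
    obtain ⟨c, hc, hceq⟩ := exists_hasDerivAt_eq_slope M N hs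
      (hMc.mono (Icc_subset_Icc_right hsρ))
      (fun x hx => hM x (hsub ⟨hx.1.le, hx.2.le.trans hsρ⟩))
    have e1 : M s - M 0 = N c * s := by rw [hceq]; simp [hs.ne']
    rw [e1, abs_mul, abs_of_pos hs]
    calc |N c| * s ≤ (lam ^ 2 * ρ * S) * ρ := by
          gcongr
          exact hNb c hc.1 (hc.2.le.trans hsρ)
      _ = S / 4 := by linear_combination S * hlr
  have hm4 : S ≤ |M 0| + S / 4 := by
    rcases hm.1.eq_or_lt with h | h
    · rw [hSdef, ← h]; linarith [abs_nonneg (M 0)]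
    · have := hMb m h hm.2
      have := abs_sub_abs_le_abs_sub (M m) (M 0)
      linarith
  have h5 := hMb ρ hρ0 le_rfl
  have h6 := abs_sub_abs_le_abs_sub (M 0) (M ρ)
  rw [abs_sub_comm] at h6
  linarith

theorem lh_mean {n : ℕ} (hn : 2 ≤ n) (d : ℝ)
    (hfin : μH[d] (sphere (0 : EuclideanSpace ℝ (Fin n)) 1) ≠ ⊤)
    (lam ρ R : ℝ) (hl : 0 < lam) (hρ : ρ = 1 / 2 / lam) (hR : ρ < R)
    (x₀ : EuclideanSpace ℝ (Fin n))
    (ψ : EuclideanSpace ℝ (Fin n) → ℝ) (hψ : ContDiffOn ℝ 2 ψ (ball x₀ R))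
    (hlap : ∀ y ∈ ball x₀ R, lap ψ y = -lam ^ 2 * ψ y) :
    |(μH[d] : Measure (EuclideanSpace ℝ (Fin n))).real (sphere 0 1) * ψ x₀| ≤
      3 / 2 * |∫ w in sphere (0 : EuclideanSpace ℝ (Fin n)) 1, ψ (x₀ + ρ • w) ∂(μH[d])| := by
  let F : Fin n → EuclideanSpace ℝ (Fin n) → ℝ := fun j y =>
    fderiv ℝ ψ y (EuclideanSpace.single j 1)
  have hF : ∀ j, ContDiffOn ℝ 1 (F j) (ball x₀ R) := fun j =>
    (hψ.fderiv_of_isOpen isOpen_ball (by norm_num)).clm_apply contDiffOn_const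
  obtain ⟨k, rfl⟩ : ∃ k, n = k + 2 := ⟨n - 2, by omega⟩
  have hM0 : (∫ w in sphere (0 : EuclideanSpace ℝ (Fin (k + 2))) 1,
      ψ (x₀ + (0 : ℝ) • w) ∂(μH[d]))
      = (μH[d] : Measure (EuclideanSpace ℝ (Fin (k + 2)))).real (sphere 0 1) * ψ x₀ := by
    simp
  rw [← hM0]
  refine lh_ode k lam ρ R hl hρ hR (fun r => ∫ w in sphere (0 : EuclideanSpace ℝ (Fin (k + 2))) 1,
      ψ (x₀ + r • w) ∂(μH[d]))
    (fun r => ∫ w in sphere (0 : EuclideanSpace ℝ (Fin (k + 2))) 1,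
      ∑ j, w j * F j (x₀ + r • w) ∂(μH[d]))
    (fun r => ∫ w in sphere (0 : EuclideanSpace ℝ (Fin (k + 2))) 1,
      ∑ j, w j * fderiv ℝ (F j) (x₀ + r • w) w ∂(μH[d])) ?_ ?_ ?_
  · intro r hr
    have h1 := lh_radial d hfin x₀ R (ι := Unit) (fun _ _ => 1) (fun _ => ψ)
      (fun _ => continuous_const) (fun _ => hψ.of_le (by norm_num)) r hr
    simp only [Finset.univ_unique, Finset.sum_singleton, one_mul] at h1
    refine h1.congr_deriv ?_
    refine setIntegral_congr_fun isClosed_sphere.measurableSet fun w hw => ?_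
    simp only [F]
    generalize fderiv ℝ ψ (x₀ + r • w) = T
    have hwv : w = ∑ i, w i • EuclideanSpace.single i (1 : ℝ) := by
      ext k; simp [Finset.sum_apply, Pi.single_apply]
    conv_lhs => rw [hwv]
    simp only [map_sum, map_smul, smul_eq_mul]
  · intro r hr
    exact lh_radial d hfin x₀ R (fun j w => w j) F (fun j => by fun_prop) hF r hr
  · intro r hr hrR
    have h1 := lh_div d hfin x₀ R r hr hrR F hF
    have h2 : (∫ w in sphere (0 : EuclideanSpace ℝ (Fin (k + 2))) 1,
        ∑ j, fderiv ℝ (F j) (x₀ + r • w) (EuclideanSpace.single j 1) ∂(μH[d]))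
        = - lam ^ 2 * ∫ w in sphere (0 : EuclideanSpace ℝ (Fin (k + 2))) 1,
          ψ (x₀ + r • w) ∂(μH[d]) := by
      rw [← integral_const_mul]
      refine setIntegral_congr_fun isClosed_sphere.measurableSet fun w hw => ?_
      have hw' : ‖w‖ = 1 := by simpa using hw
      exact hlap _ (by simp [norm_smul, hw', abs_of_pos hr, hrR])
    rw [h2] at h1
    push_cast at h1
    linear_combination -h1

theorem lh_pos (m : ℕ) : 0 < μH[(m : ℝ)] (sphere (0 : EuclideanSpace ℝ (Fin (m + 1))) 1) := by
  let P : EuclideanSpace ℝ (Fin (m + 1)) → (Fin m → ℝ) := fun x i => x i.succ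
  have hP : LipschitzWith 1 P := by
    refine LipschitzWith.of_dist_le_mul fun x y => ?_
    rw [dist_pi_le_iff (by positivity)]
    intro i
    simp only [P, NNReal.coe_one, one_mul, dist_eq_norm]
    exact PiLp.norm_apply_le (x - y) i.succ
  have h1 := hP.hausdorffMeasure_image_le (d := (m : ℝ)) (by positivity)
    (sphere (0 : EuclideanSpace ℝ (Fin (m + 1))) 1)
  have hV : {v : Fin m → ℝ | ∑ i, v i ^ 2 < 1} ⊆ P '' sphere 0 1 := by
    intro v hv
    have hv' : ∑ i, v i ^ 2 < 1 := hv
    refine ⟨WithLp.toLp 2 (Fin.cons (Real.sqrt (1 - ∑ i, v i ^ 2)) v), ?_, ?_⟩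
    · have h2 : ‖(WithLp.toLp 2 (Fin.cons (Real.sqrt (1 - ∑ i, v i ^ 2)) v) :
          EuclideanSpace ℝ (Fin (m + 1)))‖ ^ 2 = 1 := by
        rw [EuclideanSpace.real_norm_sq_eq, Fin.sum_univ_succ]
        simp only [Fin.cons_zero, Fin.cons_succ]
        rw [Real.sq_sqrt (by linarith)]; ring
      rw [mem_sphere_zero_iff_norm]
      exact (pow_eq_one_iff_of_nonneg (norm_nonneg _) two_ne_zero).1 h2
    · ext i; simp [P]
  have hopen : IsOpen {v : Fin m → ℝ | ∑ i, v i ^ 2 < 1} :=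
    isOpen_lt (by fun_prop) continuous_const
  have hpos : 0 < μH[(m : ℝ)] {v : Fin m → ℝ | ∑ i, v i ^ 2 < 1} := by
    have := hausdorffMeasure_pi_real (ι := Fin m)
    rw [Fintype.card_fin] at this
    rw [this]
    exact hopen.measure_pos _ ⟨0, by simp⟩
  refine lt_of_lt_of_le (hpos.trans_le (measure_mono hV)) (h1.trans ?_)
  simp

theorem lh_fin (m : ℕ) : μH[(m : ℝ)] (sphere (0 : EuclideanSpace ℝ (Fin (m + 1))) 1) ≠ ⊤ := by
  let X : Fin (m + 1) → (Fin m → ℝ) → EuclideanSpace ℝ (Fin (m + 1)) := fun i v =>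
    WithLp.toLp 2 (Fin.insertNth i (1 : ℝ) v)
  have hXi : ∀ i v, (X i v) i = 1 := by intro i v; simp [X]
  have hX0 : ∀ i v, X i v ≠ 0 := by
    intro i v h
    have := hXi i v
    rw [h] at this
    simp at this
  have hXc : ∀ i, ContDiff ℝ 1 (X i) := by
    intro i
    rw [contDiff_euclidean]
    intro k
    rcases eq_or_ne k i with rfl | hk
    · simp only [hXi]; exact contDiff_const
    · obtain ⟨j, rfl⟩ := Fin.exists_succAbove_eq hk
      simp only [X, Fin.insertNth_apply_succAbove]
      fun_prop
  let T : Fin (m + 1) → ℝ → (Fin m → ℝ) → EuclideanSpace ℝ (Fin (m + 1)) := fun i s v =>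
    (s * ‖X i v‖⁻¹) • X i v
  have hTc : ∀ i s, ContDiff ℝ 1 (T i s) := by
    intro i s
    exact (contDiff_const.mul (((hXc i).norm ℝ (hX0 i)).inv
      fun v => norm_ne_zero_iff.2 (hX0 i v))).smul (hXc i)
  have hTf : ∀ i s, μH[(m : ℝ)] (T i s '' closedBall 0 1) < ⊤ := by
    intro i s
    obtain ⟨K, hK⟩ := ((hTc i s).locallyLipschitz.locallyLipschitzOn
      (s := closedBall 0 1)).exists_lipschitzOnWith_of_compact (isCompact_closedBall 0 1)
    refine (hK.hausdorffMeasure_image_le (d := (m : ℝ)) (by positivity)).trans_lt ?_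
    have := hausdorffMeasure_pi_real (ι := Fin m)
    rw [Fintype.card_fin] at this
    rw [this]
    exact ENNReal.mul_lt_top (ENNReal.rpow_lt_top_of_nonneg (by positivity) (by simp))
      (isCompact_closedBall _ _).measure_lt_top
  have hcov : sphere (0 : EuclideanSpace ℝ (Fin (m + 1))) 1 ⊆
      ⋃ i, (T i 1 '' closedBall 0 1 ∪ T i (-1) '' closedBall 0 1) := by
    intro w hw
    have hw' : ‖w‖ = 1 := by simpa using hw
    obtain ⟨i, -, hi⟩ := Finset.exists_max_image Finset.univ (fun i => |w i|) Finset.univ_nonempty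
    have hwi : w i ≠ 0 := by
      intro h0
      have : w = 0 := by
        ext k
        have := hi k (Finset.mem_univ _)
        simp only [h0, abs_zero] at this
        simpa using this
      rw [this] at hw'; simp at hw'
    refine mem_iUnion.2 ⟨i, ?_⟩
    let v : Fin m → ℝ := fun j => w (i.succAbove j) / w i
    have hv : v ∈ closedBall (0 : Fin m → ℝ) 1 := by
      rw [mem_closedBall_zero_iff, pi_norm_le_iff_of_nonneg zero_le_one]
      intro j
      simp only [v, Real.norm_eq_abs, abs_div]
      exact div_le_one_of_le₀ (hi _ (Finset.mem_univ _)) (abs_nonneg _)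
    have hXv : X i v = (w i)⁻¹ • w := by
      ext k
      rcases eq_or_ne k i with rfl | hk
      · simp [hXi, hwi]
      · obtain ⟨j, rfl⟩ := Fin.exists_succAbove_eq hk
        simp [X, v, div_eq_inv_mul]
    have hTv : ∀ s, T i s v = (s * |w i| * (w i)⁻¹) • w := by
      intro s
      simp [T, hXv, norm_smul, hw', smul_smul]
    rcases lt_or_gt_of_ne hwi with h | h
    · right
      refine ⟨v, hv, ?_⟩
      rw [hTv, abs_of_neg h]; simp [hwi]
    · left
      refine ⟨v, hv, ?_⟩
      rw [hTv, abs_of_pos h]; simp [hwi]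
  refine ne_of_lt ((measure_mono hcov).trans_lt ?_)
  refine (measure_iUnion_fintype_le _ _).trans_lt (ENNReal.sum_lt_top.2 fun i _ => ?_)
  exact (measure_union_le _ _).trans_lt (ENNReal.add_lt_top.2 ⟨hTf i 1, hTf i (-1)⟩)

theorem lh_scale {n : ℕ} (d : ℝ) (hd : 0 ≤ d) (ρ : ℝ) (hρ : 0 < ρ)
    (x₀ : EuclideanSpace ℝ (Fin n)) (g : EuclideanSpace ℝ (Fin n) → ℝ) :
    ∫ w in sphere (0 : EuclideanSpace ℝ (Fin n)) 1, g (x₀ + ρ • w) ∂(μH[d])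
      = (ρ⁻¹) ^ d * ∫ y in sphere x₀ ρ, g y ∂(μH[d]) := by
  have h2 : ∫ y in sphere (0 : EuclideanSpace ℝ (Fin n)) ρ, g (x₀ + y) ∂(μH[d])
      = ∫ y in sphere x₀ ρ, g y ∂(μH[d]) := by
    have := ((IsometryEquiv.addLeft x₀).measurePreserving_hausdorffMeasure d).setIntegral_preimage_emb
      ((IsometryEquiv.addLeft x₀).toHomeomorph.measurableEmbedding) g (sphere x₀ ρ)
    rw [← this]
    have hs : (IsometryEquiv.addLeft x₀ : EuclideanSpace ℝ (Fin n) → _) ⁻¹' sphere x₀ ρ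
      = sphere 0 ρ := by ext y; simp
    rw [hs]; rfl
  have hmap := map_homothety_hausdorffMeasure (𝕜 := ℝ) hd
    (0 : EuclideanSpace ℝ (Fin n)) hρ.ne'
  have hfun : (AffineMap.homothety (0 : EuclideanSpace ℝ (Fin n)) ρ : EuclideanSpace ℝ (Fin n) → _)
      = fun w => ρ • w := by
    funext w; simp [AffineMap.homothety_apply]
  rw [hfun] at hmap
  have hemb : MeasurableEmbedding (fun w : EuclideanSpace ℝ (Fin n) => ρ • w) :=
    (Homeomorph.smulOfNeZero ρ hρ.ne').measurableEmbedding
  have h3 := hemb.setIntegral_map (μ := μH[d]) (fun y => g (x₀ + y)) (sphere 0 ρ)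
  have hs : (fun w : EuclideanSpace ℝ (Fin n) => ρ • w) ⁻¹' sphere 0 ρ = sphere 0 1 := by
    ext y; simp [norm_smul, abs_of_pos hρ, hρ.ne']
  rw [hs, hmap, Measure.restrict_smul, integral_smul_nnreal_measure, h2] at h3
  rw [← h3, NNReal.smul_def]
  simp [abs_of_pos hρ]

theorem local_hormander_Lp
    (n : ℕ) (hn : 2 ≤ n) (p : ℝ) (hp : 2 ≤ p) :
    ∃ κ C : ℝ, 0 < κ ∧ 0 < C ∧
      ∀ lam : ℝ, 0 < lam → ∀ x₀ : EuclideanSpace ℝ (Fin n), ∀ R : ℝ, κ / lam < R →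
        ∀ ψ : EuclideanSpace ℝ (Fin n) → ℝ,
          ContDiffOn ℝ 2 ψ (ball x₀ R) →
          (∀ y ∈ ball x₀ R, lap ψ y = -lam ^ 2 * ψ y) →
          |ψ x₀| ≤ C * lam ^ (((n : ℝ) - 1) / p)
            * (∫ y in sphere x₀ (κ / lam), |ψ y| ^ p ∂(μH[(n : ℝ) - 1])) ^ ((1 : ℝ) / p) := by

  obtain ⟨k, rfl⟩ : ∃ k, n = k + 1 := ⟨n - 1, by omega⟩
  have hd : ((k + 1 : ℕ) : ℝ) - 1 = (k : ℝ) := by push_cast; ring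
  rw [hd]
  have hfin := lh_fin k
  set σ := (μH[(k : ℝ)] : Measure (EuclideanSpace ℝ (Fin (k + 1)))).real (sphere 0 1) with hσ
  have hσ0 : 0 < σ := ENNReal.toReal_pos (lh_pos k).ne' hfin
  have hp0 : 0 < p := by linarith
  have hpq : p.HolderConjugate (Real.conjExponent p) := .conjExponent (by linarith)
  set q := Real.conjExponent p
  refine ⟨1 / 2, 3 / 2 * (σ ^ (1 / q) / σ) * 2 ^ ((k : ℝ) / p), by norm_num, by positivity, ?_⟩
  intro lam hl x₀ R hR ψ hψ hlap
  set ρ := 1 / 2 / lam with hρ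
  have hρ0 : 0 < ρ := by positivity
  have h1 := lh_mean hn k hfin lam ρ R hl hρ hR x₀ ψ hψ hlap
  rw [← hσ, abs_mul, abs_of_pos hσ0] at h1
  have hcont : ContinuousOn (fun w => ψ (x₀ + ρ • w))
      (sphere (0 : EuclideanSpace ℝ (Fin (k + 1))) 1) := by
    refine hψ.continuousOn.comp (by fun_prop) fun w hw => ?_
    have hw' : ‖w‖ = 1 := by simpa using hw
    simp [norm_smul, hw', abs_of_pos hρ0, hR]
  have hm : MeasurableSet (sphere (0 : EuclideanSpace ℝ (Fin (k + 1))) 1) :=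
    isClosed_sphere.measurableSet
  have hfm : IsFiniteMeasure
      ((μH[(k : ℝ)]).restrict (sphere (0 : EuclideanSpace ℝ (Fin (k + 1))) 1)) :=
    ⟨by simpa using lt_top_iff_ne_top.2 hfin⟩
  obtain ⟨B, hB⟩ := (isCompact_sphere (0 : EuclideanSpace ℝ (Fin (k + 1))) 1).exists_bound_of_continuousOn
    hcont.abs
  have hmem : MemLp (fun w => |ψ (x₀ + ρ • w)|) (ENNReal.ofReal p)
      ((μH[(k : ℝ)]).restrict (sphere (0 : EuclideanSpace ℝ (Fin (k + 1))) 1)) :=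
    MemLp.of_bound (hcont.abs.aestronglyMeasurable hm) B ((ae_restrict_iff' hm).2 (ae_of_all _ hB))
  have h2 := integral_mul_le_Lp_mul_Lq_of_nonneg hpq
    (ae_of_all _ fun w => abs_nonneg (ψ (x₀ + ρ • w))) (ae_of_all _ fun w => zero_le_one)
    hmem (memLp_const (1 : ℝ))
  simp only [mul_one, Real.one_rpow, integral_const, MeasurableSet.univ, measureReal_restrict_apply,
    univ_inter, smul_eq_mul, ← hσ] at h2
  rw [lh_scale (k : ℝ) (by positivity) ρ hρ0 x₀ (fun y => |ψ y| ^ p)] at h2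
  have h3 : |∫ w in sphere (0 : EuclideanSpace ℝ (Fin (k + 1))) 1, ψ (x₀ + ρ • w) ∂(μH[(k : ℝ)])|
      ≤ ∫ w in sphere (0 : EuclideanSpace ℝ (Fin (k + 1))) 1, |ψ (x₀ + ρ • w)| ∂(μH[(k : ℝ)]) :=
    abs_integral_le_integral_abs
  set I := ∫ y in sphere x₀ ρ, |ψ y| ^ p ∂(μH[(k : ℝ)]) with hI
  have hI0 : 0 ≤ I := integral_nonneg fun y => by positivity
  have hρi : ρ⁻¹ = 2 * lam := by rw [hρ]; field_simp
  have h4 : ((ρ⁻¹) ^ (k : ℝ) * I) ^ (1 / p)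
      = 2 ^ ((k : ℝ) / p) * lam ^ ((k : ℝ) / p) * I ^ (1 / p) := by
    rw [Real.mul_rpow (by positivity) hI0, ← Real.rpow_mul (by positivity), hρi,
      Real.mul_rpow (by norm_num) hl.le, mul_one_div]
  rw [h4] at h2
  have h5 : σ * |ψ x₀| ≤ 3 / 2 * (2 ^ ((k : ℝ) / p) * lam ^ ((k : ℝ) / p) * I ^ (1 / p)
      * σ ^ (1 / q)) := by linarith
  rw [← le_div_iff₀' hσ0] at h5
  refine h5.trans_eq ?_
  ring
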